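/- (Recurrence relation for the second sequence.) Let N ≥ 2. If N is even, then E_{μ_{N,1}}[b] = (μ_{N−1,1}(Γ)/μ_{N,1}(Γ)) · ( (m+n+1)·E_{μ_{N−1,1}}[b] + ( n(n+2) + (N−2)(m+n)(m+n+2) )/6 ). If N is odd, then E_{μ_{N,1}}[a] = (μ_{N−1,1}(Γ)/μ_{N,1}(Γ)) · ( (m+n+1)·E_{μ_{N−1,1}}[a] + ( n(n+2) + (N−2)(m+n)(m+n+2) )/6 ). -/

import Mathlib

open Finsupp Filter

noncomputable section

/-- Signed-sum convention: `signedSum c k = Σ_{i=0}^{k} c i`, which is the ordinary sum for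
`k ≥ 0`, is `0` for `k = -1`, and equals `-(c (-1) + c (-2) + ⋯ + c (k+1))` for `k ≤ -2`. -/
def signedSum {M : Type*} [AddCommGroup M] (c : ℤ → M) (k : ℤ) : M :=
  (∑ i ∈ Finset.range (k + 1).toNat, c i) -
    ∑ i ∈ Finset.range (-(k + 1)).toNat, c (-((i : ℤ) + 1))

/-- The Demazure operator `D₀` (relative to `Λ = mΛ₀ + nΛ₁`):
`D₀ δ_{(a,b)} = Σ_{i=0}^{m - 2(a-b)} δ_{(a+i,b)}`, extended ℤ-linearly. -/
def D0 (m : ℕ) (μ : ℤ × ℤ →₀ ℤ) : ℤ × ℤ →₀ ℤ :=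
  μ.sum fun p c =>
    c • signedSum (fun i => Finsupp.single (p.1 + i, p.2) (1 : ℤ)) ((m : ℤ) - 2 * (p.1 - p.2))

/-- The Demazure operator `D₁` (relative to `Λ = mΛ₀ + nΛ₁`):
`D₁ δ_{(a,b)} = Σ_{i=0}^{n + 2(a-b)} δ_{(a,b+i)}`, extended ℤ-linearly. -/
def D1 (n : ℕ) (μ : ℤ × ℤ →₀ ℤ) : ℤ × ℤ →₀ ℤ :=
  μ.sum fun p c =>
    c • signedSum (fun i => Finsupp.single (p.1, p.2 + i) (1 : ℤ)) ((n : ℤ) + 2 * (p.1 - p.2))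

/-- Total mass `μ(Γ)` of a finitely supported function on `ℤ × ℤ`. -/
def mass (μ : ℤ × ℤ →₀ ℤ) : ℤ := μ.sum fun _ c => c

/-- Expected value `E_ν[f] = (1/ν(Γ)) Σ ν(a,b) f(a,b)`. -/
def expVal (ν : ℤ × ℤ →₀ ℤ) (f : ℤ × ℤ → ℚ) : ℚ :=
  (mass ν : ℚ)⁻¹ * ν.sum fun p c => (c : ℚ) * f p

/-- Covariance `Cov_ν(f,g) = E_ν[f·g] - E_ν[f]·E_ν[g]`. -/
def cov (ν : ℤ × ℤ →₀ ℤ) (f g : ℤ × ℤ → ℚ) : ℚ :=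
  expVal ν (fun p => f p * g p) - expVal ν f * expVal ν g

/-- Variance `Var_ν(f) = Cov_ν(f,f)`. -/
def var (ν : ℤ × ℤ →₀ ℤ) (f : ℤ × ℤ → ℚ) : ℚ := cov ν f f

/-- The coordinate function `a` (the degree). -/
def fa : ℤ × ℤ → ℚ := fun p => (p.1 : ℚ)

/-- The coordinate function `b`. -/
def fb : ℤ × ℤ → ℚ := fun p => (p.2 : ℚ)

/-- The finite-weight coordinate `a - b`. -/
def fab : ℤ × ℤ → ℚ := fun p => (p.1 : ℚ) - (p.2 : ℚ)

/-- `μ_{N,0}`: start from `δ_{(0,0)}`, apply `D₀` at odd steps and `D₁` at even steps. -/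
def mu0 (m n : ℕ) : ℕ → (ℤ × ℤ →₀ ℤ)
  | 0 => Finsupp.single (0, 0) 1
  | N + 1 => if N % 2 = 0 then D0 m (mu0 m n N) else D1 n (mu0 m n N)

/-- `μ_{N,1}`: start from `δ_{(0,0)}`, apply `D₁` at odd steps and `D₀` at even steps. -/
def mu1 (m n : ℕ) : ℕ → (ℤ × ℤ →₀ ℤ)
  | 0 => Finsupp.single (0, 0) 1
  | N + 1 => if N % 2 = 0 then D1 n (mu1 m n N) else D0 m (mu1 m n N)

/-- A telescoping criterion for evaluating signed sums. -/
theorem signedSum_eq_sub {M : Type*} [AddCommGroup M] {c F : ℤ → M}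
    (h : ∀ i, c i = F (i + 1) - F i) (k : ℤ) : signedSum c k = F (k + 1) - F 0 := by
  have hpos : ∀ j : ℕ, ∑ i ∈ Finset.range j, c i = F j - F 0 := fun j => by
    induction j with
    | zero => simp
    | succ j ih => rw [Finset.sum_range_succ, ih, h]; push_cast; abel
  have hneg : ∀ j : ℕ, ∑ i ∈ Finset.range j, c (-((i : ℤ) + 1)) = F 0 - F (-j) := fun j => by
    induction j with
    | zero => simp
    | succ j ih =>
      rw [Finset.sum_range_succ, ih, h, show -((j : ℤ) + 1) + 1 = -j by ring]
      push_cast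
      abel
  rw [signedSum, hpos, hneg]
  rcases le_total 0 (k + 1) with hk | hk
  · rw [Int.toNat_of_nonneg hk, Int.toNat_eq_zero.2 (by lia : -(k + 1) ≤ 0)]
    simp
  · rw [Int.toNat_of_nonneg (by lia : 0 ≤ -(k + 1)), Int.toNat_eq_zero.2 hk]
    simp

theorem map_signedSum {M P : Type*} [AddCommGroup M] [AddCommGroup P] (φ : M →+ P) (c : ℤ → M)
    (k : ℤ) : φ (signedSum c k) = signedSum (fun i => φ (c i)) k := by
  simp [signedSum]

theorem signedSum_const (x : ℚ) (k : ℤ) : signedSum (fun _ => x) k = (k + 1) * x := by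
  rw [signedSum_eq_sub (F := fun i => i * x) (by intro i; push_cast; ring)]
  push_cast
  ring

theorem signedSum_weight (k : ℤ) : signedSum (fun i => (k - 2 * i : ℚ)) k = 0 := by
  rw [signedSum_eq_sub (F := fun i => (k * i - i * (i - 1) : ℚ)) (by intro i; push_cast; ring)]
  push_cast
  ring

theorem signedSum_weight_sq (k : ℤ) :
    signedSum (fun i => (k - 2 * i : ℚ) ^ 2) k = k * (k + 1) * (k + 2) / 3 := by
  rw [signedSum_eq_sub
    (F := fun i => (k ^ 2 * i - 2 * k * i * (i - 1) + 2 * (i - 1) * i * (2 * i - 1) / 3 : ℚ))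
    (by intro i; push_cast; ring)]
  push_cast
  ring

theorem signedSum_weight_cube (k : ℤ) : signedSum (fun i => (k - 2 * i : ℚ) ^ 3) k = 0 := by
  rw [signedSum_eq_sub
    (F := fun i => (k ^ 3 * i - 3 * k ^ 2 * i * (i - 1) + 2 * k * (i - 1) * i * (2 * i - 1)
      - 2 * i ^ 2 * (i - 1) ^ 2 : ℚ))
    (by intro i; push_cast; ring)]
  push_cast
  ring

theorem signedSum_weight_mul (x : ℚ) (k : ℤ) :
    signedSum (fun i => (k - 2 * i : ℚ) * (x + i)) k = -(k * (k + 1) * (k + 2) / 6) := by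
  rw [signedSum_eq_sub
    (F := fun i => ((x + k / 2) * (k * i - i * (i - 1))
      - (k ^ 2 * i - 2 * k * i * (i - 1) + 2 * (i - 1) * i * (2 * i - 1) / 3) / 2 : ℚ))
    (by intro i; push_cast; ring)]
  push_cast
  ring

/-- The sum of `f` against `ν`, as a function linear in both arguments. -/
def pairing (f : ℤ × ℤ → ℚ) (ν : ℤ × ℤ →₀ ℤ) : ℚ :=
  Finsupp.bilinearCombination ℤ ℚ f ν

theorem pairing_eq_sum (f : ℤ × ℤ → ℚ) (ν : ℤ × ℤ →₀ ℤ) :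
    pairing f ν = ν.sum fun p c => (c : ℚ) * f p := by
  simp [pairing, Finsupp.bilinearCombination_apply, Finsupp.linearCombination_apply]

theorem pairing_add (f g : ℤ × ℤ → ℚ) (ν : ℤ × ℤ →₀ ℤ) :
    pairing (fun p => f p + g p) ν = pairing f ν + pairing g ν := by
  simp only [pairing_eq_sum, Finsupp.sum, mul_add, Finset.sum_add_distrib]

theorem pairing_const_mul (r : ℚ) (f : ℤ × ℤ → ℚ) (ν : ℤ × ℤ →₀ ℤ) :
    pairing (fun p => r * f p) ν = r * pairing f ν := by
  simp only [pairing_eq_sum, Finsupp.sum, Finset.mul_sum, mul_left_comm]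

theorem cast_mass (ν : ℤ × ℤ →₀ ℤ) : (mass ν : ℚ) = pairing (fun _ => 1) ν := by
  simp [pairing_eq_sum, mass, Finsupp.sum]

theorem expVal_eq (ν : ℤ × ℤ →₀ ℤ) (f : ℤ × ℤ → ℚ) :
    expVal ν f = (mass ν : ℚ)⁻¹ * pairing f ν := by
  rw [expVal, pairing_eq_sum]

/-- The Demazure operator in the direction `v`, for the coroot with values `h`. -/
def demazureOp (v : ℤ × ℤ) (h : ℤ × ℤ → ℤ) (ν : ℤ × ℤ →₀ ℤ) : ℤ × ℤ →₀ ℤ :=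
  ν.sum fun p c => c • signedSum (fun i => Finsupp.single (p + i • v) (1 : ℤ)) (h p)

theorem D0_eq_demazureOp (m : ℕ) (ν : ℤ × ℤ →₀ ℤ) :
    D0 m ν = demazureOp (1, 0) (fun p => m - 2 * (p.1 - p.2)) ν := by
  simp [D0, demazureOp, Prod.add_def]

theorem D1_eq_demazureOp (n : ℕ) (ν : ℤ × ℤ →₀ ℤ) :
    D1 n ν = demazureOp (0, 1) (fun p => n + 2 * (p.1 - p.2)) ν := by
  simp [D1, demazureOp, Prod.add_def]

theorem pairing_demazureOp (v : ℤ × ℤ) (h : ℤ × ℤ → ℤ) (f : ℤ × ℤ → ℚ) (ν : ℤ × ℤ →₀ ℤ) :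
    pairing f (demazureOp v h ν) =
      pairing (fun p => signedSum (fun i => f (p + i • v)) (h p)) ν := by
  rw [pairing_eq_sum fun p => signedSum (fun i => f (p + i • v)) (h p)]
  rw [pairing, demazureOp, map_finsuppSum]
  refine Finsupp.sum_congr fun p _ => ?_
  rw [map_zsmul, zsmul_eq_mul]
  congr 1
  refine (map_signedSum (Finsupp.bilinearCombination ℤ ℚ f).toAddMonoidHom _ _).trans ?_
  simp [Finsupp.bilinearCombination_apply]

/-- The weights `h` are distributed under `ν` with vanishing first and third moments and with
second moment `e` times the total mass. -/
structure BalancedWeights (h : ℤ × ℤ → ℤ) (e : ℚ) (ν : ℤ × ℤ →₀ ℤ) : Prop where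
  moment_one : pairing (fun p => (h p : ℚ)) ν = 0
  moment_three : pairing (fun p => (h p : ℚ) ^ 3) ν = 0
  moment_two : pairing (fun p => (h p : ℚ) ^ 2) ν = e * pairing (fun _ => 1) ν

section

variable {v : ℤ × ℤ} {h : ℤ × ℤ → ℤ}

theorem pairing_demazureOp_of_invariant {g : ℤ × ℤ → ℚ} (hg : ∀ p (i : ℤ), g (p + i • v) = g p)
    (ν : ℤ × ℤ →₀ ℤ) :
    pairing g (demazureOp v h ν) = pairing (fun p => ((h p : ℚ) + 1) * g p) ν := by
  simp only [pairing_demazureOp, hg, signedSum_const]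

theorem balanced_demazureOp (hv : ∀ p (i : ℤ), h (p + i • v) = h p - 2 * i) {e : ℚ}
    {ν : ℤ × ℤ →₀ ℤ}
    (he : pairing (fun p => (h p * (h p + 1) * (h p + 2) / 3 : ℚ)) ν =
      e * pairing (fun p => ((h p : ℚ) + 1) * 1) ν) :
    BalancedWeights h e (demazureOp v h ν) where
  moment_one := by
    simp only [pairing_demazureOp, hv, Int.cast_sub, Int.cast_mul, Int.cast_ofNat,
      signedSum_weight]
    simp [pairing_eq_sum]
  moment_three := by
    simp only [pairing_demazureOp, hv, Int.cast_sub, Int.cast_mul, Int.cast_ofNat,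
      signedSum_weight_cube]
    simp [pairing_eq_sum]
  moment_two := by
    simpa only [pairing_demazureOp, hv, Int.cast_sub, Int.cast_mul, Int.cast_ofNat,
      signedSum_weight_sq, signedSum_const] using he

theorem pairing_weight_mul_demazureOp (hv : ∀ p (i : ℤ), h (p + i • v) = h p - 2 * i)
    {g : ℤ × ℤ → ℚ} (hg : ∀ p (i : ℤ), g (p + i • v) = g p + i) {e : ℚ} {ν : ℤ × ℤ →₀ ℤ}
    (hb : BalancedWeights h e (demazureOp v h ν)) :
    pairing (fun p => h p * g p) (demazureOp v h ν) =
      -(e / 2) * pairing (fun _ => 1) (demazureOp v h ν) := by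
  have h2 := hb.moment_two
  rw [pairing_demazureOp] at h2 ⊢
  simp only [hv, hg, Int.cast_sub, Int.cast_mul, Int.cast_ofNat, signedSum_weight_sq,
    signedSum_weight_mul] at h2 ⊢
  rw [neg_mul, div_mul_eq_mul_div, ← h2, ← neg_div, ← neg_one_mul, mul_div_right_comm,
    ← pairing_const_mul]
  congr 1
  funext p
  ring

theorem BalancedWeights.demazureOp {h' : ℤ × ℤ → ℤ} {s e : ℚ} {ν : ℤ × ℤ →₀ ℤ}
    (hv : ∀ p (i : ℤ), h (p + i • v) = h p - 2 * i) (hs : ∀ p, (h p : ℚ) = s - h' p)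
    (hb : BalancedWeights h' e ν) :
    BalancedWeights h (e + s * (s + 2) / 3) (demazureOp v h ν) := by
  apply balanced_demazureOp hv
  have hone : (fun p => ((h p : ℚ) + 1) * 1) = fun p => (s + 1) * 1 + (-1) * (h' p : ℚ) := by
    funext p
    rw [hs]
    ring
  have htwo : (fun p => (h p * (h p + 1) * (h p + 2) / 3 : ℚ)) = fun p =>
      (s * (s + 1) * (s + 2) / 3) * 1 + ((-(3 * s ^ 2 + 6 * s + 2) / 3) * (h' p : ℚ) +
        ((s + 1) * (h' p : ℚ) ^ 2 + (-1 / 3) * (h' p : ℚ) ^ 3)) := by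
    funext p
    rw [hs]
    ring
  rw [hone, htwo]
  simp only [pairing_add, pairing_const_mul, hb.moment_one, hb.moment_two, hb.moment_three]
  ring

theorem expVal_demazureOp {w : ℤ × ℤ} {h' : ℤ × ℤ → ℤ} {g : ℤ × ℤ → ℚ} {s e : ℚ}
    {ν : ℤ × ℤ →₀ ℤ} (hs : ∀ p, (h' p : ℚ) = s - h p)
    (hv : ∀ p (i : ℤ), h (p + i • v) = h p - 2 * i)
    (hgv : ∀ p (i : ℤ), g (p + i • v) = g p + i) (hgw : ∀ p (i : ℤ), g (p + i • w) = g p)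
    (hb : BalancedWeights h e (demazureOp v h ν)) (hm : (mass (demazureOp v h ν) : ℚ) ≠ 0) :
    expVal (demazureOp w h' (demazureOp v h ν)) g =
      (mass (demazureOp v h ν) : ℚ) / mass (demazureOp w h' (demazureOp v h ν)) *
        ((s + 1) * expVal (demazureOp v h ν) g + e / 2) := by
  have key : pairing g (demazureOp w h' (demazureOp v h ν)) =
      (s + 1) * pairing g (demazureOp v h ν) + e / 2 * mass (demazureOp v h ν) := by
    have : (fun p => ((h' p : ℚ) + 1) * g p) =
        fun p => (s + 1) * g p + (-1) * (h p * g p) := by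
      funext p
      rw [hs]
      ring
    rw [pairing_demazureOp_of_invariant hgw, this, pairing_add, pairing_const_mul,
      pairing_const_mul, pairing_weight_mul_demazureOp hv hgv hb, cast_mass]
    ring
  rw [expVal_eq, expVal_eq, key]
  field_simp

theorem mass_demazureOp {h' : ℤ × ℤ → ℤ} {s e : ℚ} {ν : ℤ × ℤ →₀ ℤ}
    (hs : ∀ p, (h p : ℚ) = s - h' p) (hb : BalancedWeights h' e ν) :
    (mass (demazureOp v h ν) : ℚ) = (s + 1) * mass ν := by
  have : (fun p => ((h p : ℚ) + 1) * 1) = fun p => (s + 1) * 1 + (-1) * (h' p : ℚ) := by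
    funext p
    rw [hs]
    ring
  rw [cast_mass, cast_mass, pairing_demazureOp_of_invariant (fun _ _ => rfl), this, pairing_add,
    pairing_const_mul, pairing_const_mul, hb.moment_one]
  ring

end

theorem mu1_two_mul_add_one (m n k : ℕ) :
    mu1 m n (2 * k + 1) = demazureOp (0, 1) (fun p => n + 2 * (p.1 - p.2)) (mu1 m n (2 * k)) := by
  rw [← D1_eq_demazureOp, mu1, if_pos (by lia)]

theorem mu1_two_mul_add_two (m n k : ℕ) :
    mu1 m n (2 * k + 2) =
      demazureOp (1, 0) (fun p => m - 2 * (p.1 - p.2)) (mu1 m n (2 * k + 1)) := by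
  rw [← D0_eq_demazureOp, mu1, if_neg (by lia)]

theorem corootZero_add_smul (m : ℕ) (p : ℤ × ℤ) (i : ℤ) :
    (m - 2 * ((p + i • ((1 : ℤ), (0 : ℤ))).1 - (p + i • ((1 : ℤ), (0 : ℤ))).2) : ℤ) =
      m - 2 * (p.1 - p.2) - 2 * i := by
  simp
  ring

theorem corootOne_add_smul (n : ℕ) (p : ℤ × ℤ) (i : ℤ) :
    (n + 2 * ((p + i • ((0 : ℤ), (1 : ℤ))).1 - (p + i • ((0 : ℤ), (1 : ℤ))).2) : ℤ) =
      n + 2 * (p.1 - p.2) - 2 * i := by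
  simp
  ring

theorem corootZero_eq_sub (m n : ℕ) (p : ℤ × ℤ) :
    ((m - 2 * (p.1 - p.2) : ℤ) : ℚ) = m + n - (n + 2 * (p.1 - p.2) : ℤ) := by
  push_cast
  ring

theorem corootOne_eq_sub (m n : ℕ) (p : ℤ × ℤ) :
    ((n + 2 * (p.1 - p.2) : ℤ) : ℚ) = m + n - (m - 2 * (p.1 - p.2) : ℤ) := by
  push_cast
  ring

theorem balanced_mu1 (m n k : ℕ) :
    (BalancedWeights (fun p => n + 2 * (p.1 - p.2))
        ((n * (n + 2) + 2 * k * (m + n) * (m + n + 2)) / 3) (mu1 m n (2 * k + 1)) ∧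
      (mass (mu1 m n (2 * k + 1)) : ℚ) ≠ 0) ∧
    (BalancedWeights (fun p => m - 2 * (p.1 - p.2))
        ((n * (n + 2) + (2 * k + 1) * (m + n) * (m + n + 2)) / 3) (mu1 m n (2 * k + 2)) ∧
      (mass (mu1 m n (2 * k + 2)) : ℚ) ≠ 0) := by
  have hs : (m + n + 1 : ℚ) ≠ 0 := by positivity
  refine (and_iff_left_of_imp ?_).2 ?_
  · rintro ⟨hodd, hmass⟩
    rw [mu1_two_mul_add_two]
    constructor
    · convert hodd.demazureOp (corootZero_add_smul m) (corootZero_eq_sub m n) using 1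
      ring
    · rw [mass_demazureOp (corootZero_eq_sub m n) hodd]
      exact mul_ne_zero hs hmass
  · cases k with
    | zero =>
      rw [mu1_two_mul_add_one]
      constructor
      · apply balanced_demazureOp (corootOne_add_smul n)
        simp [pairing_eq_sum, mu1]
        ring
      · rw [cast_mass, pairing_demazureOp_of_invariant (fun _ _ => rfl)]
        simp [pairing_eq_sum, mu1]
        positivity
    | succ k =>
      obtain ⟨heven, hmass⟩ := (balanced_mu1 m n k).2
      rw [mu1_two_mul_add_one, show 2 * (k + 1) = 2 * k + 2 by ring]
      constructor
      · convert heven.demazureOp (corootOne_add_smul n) (corootOne_eq_sub m n) using 1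
        push_cast
        ring
      · rw [mass_demazureOp (corootOne_eq_sub m n) heven]
        exact mul_ne_zero hs hmass

/-- recurrence relation for the second sequence. -/
theorem stmt_14 (m n : ℕ) (N : ℕ) (hN : 2 ≤ N) :
    (Even N →
      expVal (mu1 m n N) fb =
        (mass (mu1 m n (N - 1)) : ℚ) / (mass (mu1 m n N) : ℚ) *
          (((m : ℚ) + (n : ℚ) + 1) * expVal (mu1 m n (N - 1)) fb +
            ((n : ℚ) * ((n : ℚ) + 2) +
              ((N : ℚ) - 2) * ((m : ℚ) + (n : ℚ)) * ((m : ℚ) + (n : ℚ) + 2)) / 6)) ∧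
    (Odd N →
      expVal (mu1 m n N) fa =
        (mass (mu1 m n (N - 1)) : ℚ) / (mass (mu1 m n N) : ℚ) *
          (((m : ℚ) + (n : ℚ) + 1) * expVal (mu1 m n (N - 1)) fa +
            ((n : ℚ) * ((n : ℚ) + 2) +
              ((N : ℚ) - 2) * ((m : ℚ) + (n : ℚ)) * ((m : ℚ) + (n : ℚ) + 2)) / 6)) := by
  have hfa0 (p : ℤ × ℤ) (i : ℤ) : fa (p + i • ((1 : ℤ), (0 : ℤ))) = fa p + i := by simp [fa]
  have hfa1 (p : ℤ × ℤ) (i : ℤ) : fa (p + i • ((0 : ℤ), (1 : ℤ))) = fa p := by simp [fa]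
  have hfb0 (p : ℤ × ℤ) (i : ℤ) : fb (p + i • ((1 : ℤ), (0 : ℤ))) = fb p := by simp [fb]
  have hfb1 (p : ℤ × ℤ) (i : ℤ) : fb (p + i • ((0 : ℤ), (1 : ℤ))) = fb p + i := by simp [fb]
  refine ⟨fun hpar => ?_, fun hpar => ?_⟩
  · obtain ⟨k, rfl⟩ : ∃ k, N = 2 * k + 2 := by
      obtain ⟨r, rfl⟩ := hpar
      exact ⟨r - 1, by lia⟩
    obtain ⟨hb, hm⟩ := (balanced_mu1 m n k).1
    rw [show 2 * k + 2 - 1 = 2 * k + 1 by lia, mu1_two_mul_add_two]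
    rw [mu1_two_mul_add_one] at hb hm ⊢
    rw [expVal_demazureOp (corootZero_eq_sub m n) (corootOne_add_smul n) hfb1 hfb0 hb hm]
    push_cast
    ring
  · obtain ⟨k, rfl⟩ : ∃ k, N = 2 * (k + 1) + 1 := by
      obtain ⟨r, rfl⟩ := hpar
      exact ⟨r - 1, by lia⟩
    obtain ⟨hb, hm⟩ := (balanced_mu1 m n k).2
    rw [Nat.add_sub_cancel, mu1_two_mul_add_one, show 2 * (k + 1) = 2 * k + 2 by ring]
    rw [mu1_two_mul_add_two] at hb hm ⊢
    rw [expVal_demazureOp (corootOne_eq_sub m n) (corootZero_add_smul m) hfa0 hfa1 hb hm]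
    push_cast
    ring
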